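/- arXiv:1308.2392 — 2 statements merged into one kernel-verified Lean document; each statement's English description precedes it below -/
import Mathlib

section
/- Let Ω ⊂ ℝ^{n+1} be bounded open and k > 1. Suppose for a sequence ε → 0 the functions u^ε ∈ C^∞(Ω) satisfy the non-divergence form regularized equation −(|Du^ε|² + ε²)^{1/(2k) − 1/2}(δ_ij − u^ε_i u^ε_j/(|Du^ε|² + ε²)) u^ε_ij = 1 in Ω, and u^ε → u uniformly on Ω for some continuous u. Then u is a viscosity solution of the levelset power mean curvature flow equation, in the test-function sense. -/
open MeasureTheory Filter Bornology
open scoped BigOperators Topology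

noncomputable section

/-- Euclidean space `ℝ^{n+1}`. -/
abbrev Euc (n : ℕ) : Type := EuclideanSpace ℝ (Fin (n + 1))

/-- The partial derivative `D_i u` at `x`. -/
def pd (n : ℕ) (u : Euc n → ℝ) (i : Fin (n + 1)) (x : Euc n) : ℝ :=
  fderiv ℝ u x (EuclideanSpace.single i 1)

/-- The second partial derivative `D_i D_j u` at `x`. -/
def pd2 (n : ℕ) (u : Euc n → ℝ) (i j : Fin (n + 1)) (x : Euc n) : ℝ :=
  pd n (pd n u j) i x

/-- The squared euclidean norm `|Du|²` of the gradient at `x`. -/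
def gradSq (n : ℕ) (u : Euc n → ℝ) (x : Euc n) : ℝ :=
  ∑ i, (pd n u i x) ^ 2

/-- `u` is a (test-function) viscosity subsolution of the levelset power mean curvature
flow equation `div(Du/|Du|) = −|Du|^{−1/k}` on `Ω`. -/
def IsViscSubsolution (n : ℕ) (k : ℝ) (Ω : Set (Euc n)) (u : Euc n → ℝ) : Prop :=
  ∀ φ : Euc n → ℝ, ContDiffOn ℝ (⊤ : ℕ∞) φ Ω → ∀ x₀ ∈ Ω,
    IsLocalMaxOn (fun x => u x - φ x) Ω x₀ →
    ((gradSq n φ x₀ ≠ 0 →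
        (-(Real.sqrt (gradSq n φ x₀) ^ (1 / k - 1))) *
          (∑ i, ∑ j, ((if i = j then (1 : ℝ) else 0) -
            pd n φ i x₀ * pd n φ j x₀ / gradSq n φ x₀) * pd2 n φ i j x₀) ≤ 1) ∧
      (gradSq n φ x₀ = 0 →
        ∃ η : Euc n, ‖η‖ ≤ 1 ∧
          (-(∑ i, ∑ j, ((if i = j then (1 : ℝ) else 0) - η i * η j) *
            pd2 n φ i j x₀)) ≤ 0))

/-- `u` is a (test-function) viscosity supersolution of the levelset power mean curvature
flow equation `div(Du/|Du|) = −|Du|^{−1/k}` on `Ω`. -/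
def IsViscSupersolution (n : ℕ) (k : ℝ) (Ω : Set (Euc n)) (u : Euc n → ℝ) : Prop :=
  ∀ φ : Euc n → ℝ, ContDiffOn ℝ (⊤ : ℕ∞) φ Ω → ∀ x₀ ∈ Ω,
    IsLocalMinOn (fun x => u x - φ x) Ω x₀ →
    ((gradSq n φ x₀ ≠ 0 →
        1 ≤ (-(Real.sqrt (gradSq n φ x₀) ^ (1 / k - 1))) *
          (∑ i, ∑ j, ((if i = j then (1 : ℝ) else 0) -
            pd n φ i x₀ * pd n φ j x₀ / gradSq n φ x₀) * pd2 n φ i j x₀)) ∧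
      (gradSq n φ x₀ = 0 →
        ∃ η : Euc n, ‖η‖ ≤ 1 ∧
          0 ≤ (-(∑ i, ∑ j, ((if i = j then (1 : ℝ) else 0) - η i * η j) *
            pd2 n φ i j x₀))))

/-- `u` is a viscosity solution: both a viscosity subsolution and supersolution. -/
def IsViscSolution (n : ℕ) (k : ℝ) (Ω : Set (Euc n)) (u : Euc n → ℝ) : Prop :=
  IsViscSubsolution n k Ω u ∧ IsViscSupersolution n k Ω u

/-- `u` solves the regularized levelset equation
`div(Du/√(ε² + |Du|²)) = −(ε² + |Du|²)^{−1/(2k)}` in `Ω`. -/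
def SolvesReg (n : ℕ) (k ε : ℝ) (Ω : Set (Euc n)) (u : Euc n → ℝ) : Prop :=
  ∀ x ∈ Ω,
    (∑ i, pd n (fun y => pd n u i y / Real.sqrt (ε ^ 2 + gradSq n u y)) i x) =
      -((ε ^ 2 + gradSq n u x) ^ (-(1 / (2 * k))))

/-- `Ω` is a domain with smooth boundary: the sublevel set of a smooth function with
nonvanishing gradient on the boundary. -/
def HasSmoothBoundary (n : ℕ) (Ω : Set (Euc n)) : Prop :=
  ∃ f : Euc n → ℝ, ContDiff ℝ (⊤ : ℕ∞) f ∧ Ω = {x | f x < 0} ∧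
    ∀ x ∈ frontier Ω, fderiv ℝ f x ≠ 0

/-- The contraction `(δ_ij − η_i η_j) H_ij`. -/
def tangentialTrace (n : ℕ) (η : Euc n) (H : Fin (n + 1) → Fin (n + 1) → ℝ) : ℝ :=
  ∑ i, ∑ j, ((if i = j then (1 : ℝ) else 0) - η i * η j) * H i j

theorem tangentialTrace_neg (n : ℕ) (η : Euc n) (H : Fin (n + 1) → Fin (n + 1) → ℝ) :
    tangentialTrace n η (-H) = -tangentialTrace n η H := by
  simp [tangentialTrace]

theorem tangentialTrace_sub (n : ℕ) (η : Euc n) (H K : Fin (n + 1) → Fin (n + 1) → ℝ) :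
    tangentialTrace n η (H - K) = tangentialTrace n η H - tangentialTrace n η K := by
  simp [tangentialTrace, mul_sub]

theorem continuous_tangentialTrace (n : ℕ) :
    Continuous fun q : Euc n × (Fin (n + 1) → Fin (n + 1) → ℝ) => tangentialTrace n q.1 q.2 := by
  unfold tangentialTrace
  fun_prop

/-- For `|η| ≤ 1` the matrix `δ_ij − η_i η_j` is the square of `δ_ij − c η_i η_j`
with `c = 1 / (1 + √(1 − |η|²))`, so it preserves the sign of quadratic forms. -/
theorem tangentialTrace_nonpos (n : ℕ) (η : Euc n) (hη : ‖η‖ ≤ 1)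
    (H : Fin (n + 1) → Fin (n + 1) → ℝ)
    (hH : ∀ ξ : Euc n, ∑ i, ∑ j, ξ i * ξ j * H i j ≤ 0) : tangentialTrace n η H ≤ 0 := by
  have hsq : ∑ l, η l ^ 2 = ‖η‖ ^ 2 := by
    rw [EuclideanSpace.norm_sq_eq]; simp
  set s := Real.sqrt (1 - ‖η‖ ^ 2) with hs
  have hs2 : s ^ 2 = 1 - ‖η‖ ^ 2 := Real.sq_sqrt (by nlinarith [norm_nonneg η])
  have hs0 : 0 ≤ s := Real.sqrt_nonneg _
  set c := 1 / (1 + s) with hc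
  have hcc : 2 * c - c ^ 2 * ‖η‖ ^ 2 = 1 := by
    have : ‖η‖ ^ 2 = 1 - s ^ 2 := by linarith
    rw [this, hc]
    field_simp
    ring
  have hsquare : ∀ i j, (if i = j then (1 : ℝ) else 0) - η i * η j =
      ∑ l, ((if l = i then (1 : ℝ) else 0) - c * η l * η i) *
        ((if l = j then (1 : ℝ) else 0) - c * η l * η j) := by
    intro i j
    have : ∀ l, ((if l = i then (1 : ℝ) else 0) - c * η l * η i) *
        ((if l = j then (1 : ℝ) else 0) - c * η l * η j) =
        (if l = i then (if l = j then (1 : ℝ) else 0) else 0)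
        - (if l = i then c * η l * η j else 0) - (if l = j then c * η l * η i else 0)
        + c ^ 2 * η i * η j * η l ^ 2 := by
      intro l
      split_ifs <;> ring
    simp only [this, Finset.sum_add_distrib, Finset.sum_sub_distrib, Finset.sum_ite_eq',
      Finset.mem_univ, if_true, ← Finset.mul_sum, hsq]
    linear_combination (η i * η j) * hcc
  have htrace : tangentialTrace n η H = ∑ l, ∑ i, ∑ j,
      ((if l = i then (1 : ℝ) else 0) - c * η l * η i) *
        ((if l = j then (1 : ℝ) else 0) - c * η l * η j) * H i j := by
    unfold tangentialTrace
    simp only [hsquare, Finset.sum_mul]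
    rw [Finset.sum_comm]
    rw [Finset.sum_comm]
    conv_lhs =>
      enter [2, i]
      rw [Finset.sum_comm]
    rw [Finset.sum_comm]
  rw [htrace]
  exact Finset.sum_nonpos fun l _ =>
    hH (WithLp.toLp 2 fun i => (if l = i then (1 : ℝ) else 0) - c * η l * η i)

/-- A function of one variable has nonpositive second derivative at a local maximum. -/
theorem IsLocalMax.deriv_deriv_nonpos {g : ℝ → ℝ} {t : ℝ} (h : IsLocalMax g t)
    (hg : ContinuousAt g t) : deriv (deriv g) t ≤ 0 := by
  by_contra! hpos
  have hmin := isLocalMin_of_deriv_deriv_pos hpos h.deriv_eq_zero hg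
  have hconst : g =ᶠ[𝓝 t] fun _ => g t := by
    filter_upwards [h, hmin] with y h1 h2 using le_antisymm h1 h2
  have := hconst.deriv.deriv_eq
  simp at this
  linarith

theorem fderiv_apply_eq_sum_pd (n : ℕ) (f : Euc n → ℝ) (x ξ : Euc n) :
    fderiv ℝ f x ξ = ∑ j, ξ j * pd n f j x := by
  conv_lhs => rw [← (EuclideanSpace.basisFun (Fin (n + 1)) ℝ).sum_repr ξ]
  simp [pd, map_sum]

section Smooth

variable {n : ℕ} {Ω : Set (Euc n)} {f g : Euc n → ℝ} {x : Euc n}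

theorem differentiableAt_of_smoothOn (hΩ : IsOpen Ω) (hf : ContDiffOn ℝ (⊤ : ℕ∞) f Ω)
    (hx : x ∈ Ω) : DifferentiableAt ℝ f x :=
  (hf.contDiffAt (hΩ.mem_nhds hx)).differentiableAt (by simp)

theorem contDiffOn_pd (hΩ : IsOpen Ω) (hf : ContDiffOn ℝ (⊤ : ℕ∞) f Ω) (j : Fin (n + 1)) :
    ContDiffOn ℝ (⊤ : ℕ∞) (pd n f j) Ω :=
  (hf.fderiv_of_isOpen hΩ (by simp)).clm_apply contDiffOn_const

theorem pd_neg (f : Euc n → ℝ) (i : Fin (n + 1)) : pd n (-f) i = -pd n f i := by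
  ext x
  simp [pd, fderiv_neg]

theorem pd2_neg (f : Euc n → ℝ) (i j : Fin (n + 1)) (x : Euc n) :
    pd2 n (-f) i j x = -pd2 n f i j x := by
  simp [pd2, pd_neg]

theorem pd_sub (hΩ : IsOpen Ω) (hf : ContDiffOn ℝ (⊤ : ℕ∞) f Ω)
    (hg : ContDiffOn ℝ (⊤ : ℕ∞) g Ω) (hx : x ∈ Ω) (i : Fin (n + 1)) :
    pd n (f - g) i x = pd n f i x - pd n g i x := by
  unfold pd
  rw [fderiv_sub (differentiableAt_of_smoothOn hΩ hf hx) (differentiableAt_of_smoothOn hΩ hg hx)]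
  rfl

theorem pd2_sub (hΩ : IsOpen Ω) (hf : ContDiffOn ℝ (⊤ : ℕ∞) f Ω)
    (hg : ContDiffOn ℝ (⊤ : ℕ∞) g Ω) (hx : x ∈ Ω) (i j : Fin (n + 1)) :
    pd2 n (f - g) i j x = pd2 n f i j x - pd2 n g i j x := by
  have heq : pd n (f - g) j =ᶠ[𝓝 x] pd n f j - pd n g j := by
    filter_upwards [hΩ.mem_nhds hx] with y hy using pd_sub hΩ hf hg hy j
  unfold pd2
  rw [← pd_sub hΩ (contDiffOn_pd hΩ hf j) (contDiffOn_pd hΩ hg j) hx i]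
  simp only [pd, heq.fderiv_eq]

/-- The Hessian is negative semidefinite at an interior local maximum. -/
theorem sum_pd2_nonpos_of_isLocalMax (hΩ : IsOpen Ω) (hf : ContDiffOn ℝ (⊤ : ℕ∞) f Ω)
    (hx : x ∈ Ω) (hmax : IsLocalMax f x) (ξ : Euc n) :
    ∑ i, ∑ j, ξ i * ξ j * pd2 n f i j x ≤ 0 := by
  have hline : ∀ t : ℝ, HasDerivAt (fun t : ℝ => x + t • ξ) ξ t := fun t => by
    simpa using ((hasDerivAt_id t).smul_const ξ).const_add x
  have hcont : Continuous fun t : ℝ => x + t • ξ := by fun_prop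
  have hmem : ∀ᶠ t : ℝ in 𝓝 0, x + t • ξ ∈ Ω :=
    hcont.continuousAt.eventually_mem (hΩ.mem_nhds (by simpa using hx))
  have hderiv : ∀ F : Euc n → ℝ, ∀ t : ℝ, DifferentiableAt ℝ F (x + t • ξ) →
      HasDerivAt (fun t : ℝ => F (x + t • ξ)) (∑ j, ξ j * pd n F j (x + t • ξ)) t := by
    intro F t hF
    rw [← fderiv_apply_eq_sum_pd]
    exact hF.hasFDerivAt.comp_hasDerivAt t (hline t)
  have hfirst : deriv (fun t : ℝ => f (x + t • ξ)) =ᶠ[𝓝 0]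
      fun t => ∑ j, ξ j * pd n f j (x + t • ξ) := by
    filter_upwards [hmem] with t ht
    exact (hderiv f t (differentiableAt_of_smoothOn hΩ hf ht)).deriv
  have hsecond : HasDerivAt (fun t : ℝ => ∑ j, ξ j * pd n f j (x + t • ξ))
      (∑ j, ξ j * ∑ i, ξ i * pd n (pd n f j) i (x + (0 : ℝ) • ξ)) 0 := by
    refine HasDerivAt.fun_sum fun j _ => (hderiv (pd n f j) 0 ?_).const_mul _
    exact differentiableAt_of_smoothOn hΩ (contDiffOn_pd hΩ hf j) (by simpa using hx)
  have hmax' : IsLocalMax (fun t : ℝ => f (x + t • ξ)) 0 := by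
    have : Tendsto (fun t : ℝ => x + t • ξ) (𝓝 0) (𝓝 x) := by
      simpa using hcont.tendsto 0
    filter_upwards [this.eventually hmax] with t ht
    simpa using ht
  have hle := hmax'.deriv_deriv_nonpos
    (hderiv f 0 (differentiableAt_of_smoothOn hΩ hf (by simpa using hx))).continuousAt
  rw [hfirst.deriv_eq, hsecond.deriv] at hle
  rw [Finset.sum_comm]
  simpa [Finset.mul_sum, pd2, mul_assoc, mul_left_comm] using hle

end Smooth

section Quartic

variable {n : ℕ} (x₀ : Euc n)

theorem contDiff_quartic : ContDiff ℝ (⊤ : ℕ∞) fun x : Euc n => (‖x - x₀‖ ^ 2) ^ 2 :=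
  ((contDiff_id.sub contDiff_const).norm_sq ℝ).pow 2

theorem pd_quartic (j : Fin (n + 1)) :
    pd n (fun x => (‖x - x₀‖ ^ 2) ^ 2) j = fun x => ‖x - x₀‖ ^ 2 * (4 * (x j - x₀ j)) := by
  ext x
  have h := (((hasFDerivAt_id x).sub_const x₀).norm_sq).pow 2
  simp only [id] at h
  rw [pd, h.fderiv]
  simp [EuclideanSpace.inner_single_right]
  ring

theorem pd2_quartic (i j : Fin (n + 1)) :
    pd2 n (fun x => (‖x - x₀‖ ^ 2) ^ 2) i j x₀ = 0 := by
  have h2 : DifferentiableAt ℝ (fun x : Euc n => 4 * (x j - x₀ j)) x₀ := by fun_prop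
  have h3 : HasFDerivAt (fun x : Euc n => ‖x - x₀‖ ^ 2) (0 : Euc n →L[ℝ] ℝ) x₀ := by
    simpa using ((hasFDerivAt_id x₀).sub_const x₀).norm_sq
  rw [pd2, pd_quartic, pd, (h3.fun_mul h2.hasFDerivAt).fderiv]
  simp

end Quartic

/-- Perturbed contact points: if `v m → u` uniformly and `u − φ` has a local maximum at `x₀`,
then there are points `x m → x₀` at which the gradients of `v m` converge to that of `φ`
and the Hessians of `v m` are bounded above by matrices converging to that of `φ`. -/
theorem exists_contact_points {n : ℕ} {Ω : Set (Euc n)} (hΩ : IsOpen Ω)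
    {v : ℕ → Euc n → ℝ} (hv : ∀ m, ContDiffOn ℝ (⊤ : ℕ∞) (v m) Ω) {u φ : Euc n → ℝ}
    (hconv : TendstoUniformlyOn v u atTop Ω) (hφ : ContDiffOn ℝ (⊤ : ℕ∞) φ Ω)
    {x₀ : Euc n} (hx₀ : x₀ ∈ Ω) (hmax : IsLocalMaxOn (fun x => u x - φ x) Ω x₀) :
    ∃ (x : ℕ → Euc n) (X : ℕ → Fin (n + 1) → Fin (n + 1) → ℝ),
      (∀ i, Tendsto (fun m => pd n (v m) i (x m)) atTop (𝓝 (pd n φ i x₀))) ∧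
      Tendsto X atTop (𝓝 fun i j => pd2 n φ i j x₀) ∧
      ∀ᶠ m in atTop, x m ∈ Ω ∧ ∀ η : Euc n, ‖η‖ ≤ 1 →
        tangentialTrace n η (fun i j => pd2 n (v m) i j (x m)) ≤ tangentialTrace n η (X m) := by
  set w : Euc n → ℝ := fun x => (‖x - x₀‖ ^ 2) ^ 2 with hw
  have hwn : ContDiffOn ℝ (⊤ : ℕ∞) (-w) Ω := (contDiff_quartic x₀).neg.contDiffOn
  set ψ : Euc n → ℝ := φ - (-w) with hψ
  have hψs : ContDiffOn ℝ (⊤ : ℕ∞) ψ Ω := hφ.sub hwn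
  have hψ1 : ∀ i, pd n ψ i x₀ = pd n φ i x₀ := fun i => by
    rw [hψ, pd_sub hΩ hφ hwn hx₀, pd_neg, hw, pd_quartic]
    simp
  have hψ2 : ∀ i j, pd2 n ψ i j x₀ = pd2 n φ i j x₀ := fun i j => by
    rw [hψ, pd2_sub hΩ hφ hwn hx₀, pd2_neg, hw, pd2_quartic]
    simp
  obtain ⟨r, hr, hball⟩ : ∃ r > 0, ∀ y ∈ Metric.closedBall x₀ r,
      y ∈ Ω ∧ u y - φ y ≤ u x₀ - φ x₀ := by
    have := (hΩ.eventually_mem hx₀).and (hmax.isLocalMax (hΩ.mem_nhds hx₀))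
    exact Metric.nhds_basis_closedBall.eventually_iff.mp this
  have hsub : Metric.closedBall x₀ r ⊆ Ω := fun y hy => (hball y hy).1
  have hmem₀ : x₀ ∈ Metric.closedBall x₀ r := Metric.mem_closedBall_self hr.le
  have hex : ∀ m, ∃ y ∈ Metric.closedBall x₀ r,
      IsMaxOn (v m - ψ) (Metric.closedBall x₀ r) y := fun m =>
    (isCompact_closedBall x₀ r).exists_isMaxOn ⟨x₀, hmem₀⟩
      (((hv m).sub hψs).continuousOn.mono hsub)
  choose x hxmem hxmax using hex
  have hψx₀ : ψ x₀ = φ x₀ := by simp [hψ, hw]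
  have hlim : Tendsto x atTop (𝓝 x₀) := by
    rw [Metric.tendsto_atTop']
    intro δ hδ
    have hδ4 : 0 < δ ^ 4 / 2 := by positivity
    obtain ⟨N, hN⟩ := eventually_atTop.mp (Metric.tendstoUniformlyOn_iff.mp hconv _ hδ4)
    refine ⟨N, fun m hm => ?_⟩
    have h1 := hN m hm.le x₀ hx₀
    have h2 := hN m hm.le (x m) (hsub (hxmem m))
    have h3 : v m x₀ - ψ x₀ ≤ v m (x m) - ψ (x m) := hxmax m hmem₀
    have h4 := (hball _ (hxmem m)).2
    have h5 : ψ (x m) = φ (x m) + (‖x m - x₀‖ ^ 2) ^ 2 := by simp [hψ, hw]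
    rw [Real.dist_eq, abs_lt] at h1 h2
    have h6 : ‖x m - x₀‖ ^ 4 < δ ^ 4 := by
      have : (‖x m - x₀‖ ^ 2) ^ 2 = ‖x m - x₀‖ ^ 4 := by ring
      linarith [h1.1, h1.2, h2.1, h2.2]
    rw [dist_eq_norm]
    exact lt_of_pow_lt_pow_left₀ 4 hδ.le h6
  have hlocal : ∀ᶠ m in atTop, x m ∈ Ω ∧ IsLocalMax (v m - ψ) (x m) := by
    filter_upwards [hlim.eventually (Metric.ball_mem_nhds x₀ hr)] with m hm
    exact ⟨hsub (hxmem m), (hxmax m).isLocalMax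
      (mem_of_superset (Metric.isOpen_ball.mem_nhds hm) Metric.ball_subset_closedBall)⟩
  refine ⟨x, fun m i j => pd2 n ψ i j (x m), fun i => ?_, ?_, ?_⟩
  · have hc : Tendsto (fun m => pd n ψ i (x m)) atTop (𝓝 (pd n φ i x₀)) := by
      rw [← hψ1 i]
      exact (((contDiffOn_pd hΩ hψs i).continuousOn.continuousAt
        (hΩ.mem_nhds hx₀)).tendsto).comp hlim
    refine hc.congr' ?_
    filter_upwards [hlocal] with m hm
    have h0 : pd n (v m - ψ) i (x m) = 0 := by simp [pd, hm.2.fderiv_eq_zero]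
    rw [pd_sub hΩ (hv m) hψs hm.1] at h0
    linarith
  · refine tendsto_pi_nhds.mpr fun i => tendsto_pi_nhds.mpr fun j => ?_
    rw [← hψ2 i j]
    exact (((contDiffOn_pd hΩ (contDiffOn_pd hΩ hψs j) i).continuousOn.continuousAt
      (hΩ.mem_nhds hx₀)).tendsto).comp hlim
  · filter_upwards [hlocal] with m hm
    refine ⟨hm.1, fun η hη => ?_⟩
    have h := tangentialTrace_nonpos n η hη (fun i j => pd2 n (v m - ψ) i j (x m))
      (sum_pd2_nonpos_of_isLocalMax hΩ ((hv m).sub hψs) hm.1 hm.2)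
    have hH : (fun i j => pd2 n (v m - ψ) i j (x m)) =
        (fun i j => pd2 n (v m) i j (x m)) - fun i j => pd2 n ψ i j (x m) := by
      ext i j
      exact pd2_sub hΩ (hv m) hψs hm.1 i j
    rw [hH, tangentialTrace_sub] at h
    linarith

/-- The vector `p / √G`. -/
def normalizedGrad (n : ℕ) (p : Fin (n + 1) → ℝ) (G : ℝ) : Euc n :=
  WithLp.toLp 2 fun i => p i / Real.sqrt G

theorem norm_normalizedGrad_le_one (n : ℕ) (p : Fin (n + 1) → ℝ) {G : ℝ} (hG : 0 < G)
    (hp : ∑ i, p i ^ 2 ≤ G) : ‖normalizedGrad n p G‖ ≤ 1 := by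
  rw [← sq_le_one_iff₀ (norm_nonneg _), EuclideanSpace.norm_sq_eq]
  simp only [normalizedGrad, Real.norm_eq_abs, sq_abs, div_pow, Real.sq_sqrt hG.le,
    ← Finset.sum_div]
  exact (div_le_one hG).mpr hp

theorem tangentialTrace_normalizedGrad (n : ℕ) (p : Fin (n + 1) → ℝ) {G : ℝ} (hG : 0 < G)
    (H : Fin (n + 1) → Fin (n + 1) → ℝ) :
    tangentialTrace n (normalizedGrad n p G) H =
      ∑ i, ∑ j, ((if i = j then (1 : ℝ) else 0) - p i * p j / G) * H i j := by
  simp only [tangentialTrace, normalizedGrad, div_mul_div_comm, Real.mul_self_sqrt hG.le]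

theorem gradSq_nonneg (n : ℕ) (f : Euc n → ℝ) (x : Euc n) : 0 ≤ gradSq n f x :=
  Finset.sum_nonneg fun _ _ => sq_nonneg _

/-- The tangential traces along the contact points converge, after passing to a subsequence,
to that of a limit direction, which is the normalized gradient if the latter is nonzero. -/
theorem exists_limit_direction (n : ℕ) {p : ℕ → Fin (n + 1) → ℝ} {p₀ : Fin (n + 1) → ℝ}
    {G : ℕ → ℝ} (hG : ∀ m, 0 < G m) (hpG : ∀ m, ∑ i, p m i ^ 2 ≤ G m)
    (hp : Tendsto p atTop (𝓝 p₀)) (hG₀ : Tendsto G atTop (𝓝 (∑ i, p₀ i ^ 2)))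
    {X : ℕ → Fin (n + 1) → Fin (n + 1) → ℝ} {X₀ : Fin (n + 1) → Fin (n + 1) → ℝ}
    (hX : Tendsto X atTop (𝓝 X₀)) :
    ∃ (η : Euc n) (s : ℕ → ℕ), ‖η‖ ≤ 1 ∧ StrictMono s ∧
      Tendsto (fun m => tangentialTrace n (normalizedGrad n (p (s m)) (G (s m))) (X (s m)))
        atTop (𝓝 (tangentialTrace n η X₀)) ∧
      (∑ i, p₀ i ^ 2 ≠ 0 → η = normalizedGrad n p₀ (∑ i, p₀ i ^ 2)) := by
  obtain ⟨η, hη, s, hs, hlim⟩ := (isCompact_closedBall (0 : Euc n) 1).tendsto_subseq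
    (x := fun m => normalizedGrad n (p m) (G m)) fun m => by
      simpa using norm_normalizedGrad_le_one n (p m) (hG m) (hpG m)
  refine ⟨η, s, by simpa using hη, hs, ?_, fun hne => ?_⟩
  · have hpair : Tendsto (fun m => (normalizedGrad n (p (s m)) (G (s m)), X (s m))) atTop
        (𝓝 (η, X₀)) := hlim.prodMk_nhds (hX.comp hs.tendsto_atTop)
    have hcont := (continuous_tangentialTrace n).tendsto (η, X₀)
    have hcomp := hcont.comp hpair
    exact hcomp
  · refine tendsto_nhds_unique hlim ?_
    have hsqrt : Real.sqrt (∑ i, p₀ i ^ 2) ≠ 0 :=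
      (Real.sqrt_pos.mpr (lt_of_le_of_ne (Finset.sum_nonneg fun _ _ => sq_nonneg _) hne.symm)).ne'
    have hpi : Tendsto (fun m i => p m i / Real.sqrt (G m)) atTop
        (𝓝 fun i => p₀ i / Real.sqrt (∑ i, p₀ i ^ 2)) :=
      tendsto_pi_nhds.mpr fun i => (tendsto_pi_nhds.mp hp i).div hG₀.sqrt hsqrt
    exact (((PiLp.continuous_toLp 2 fun _ : Fin (n + 1) => ℝ).tendsto _).comp hpi).comp
      hs.tendsto_atTop

theorem rpow_mul_rpow_neg_eq_one {G : ℝ} (hG : 0 < G) (k : ℝ) :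
    G ^ (1 / (2 * k) - 1 / 2) * G ^ (1 / 2 - 1 / (2 * k)) = 1 := by
  rw [← Real.rpow_add hG]
  simp

theorem sqrt_rpow_eq {G : ℝ} (hG : 0 ≤ G) (k : ℝ) :
    Real.sqrt G ^ (1 / k - 1) = G ^ (1 / (2 * k) - 1 / 2) := by
  rw [Real.sqrt_eq_rpow, ← Real.rpow_mul hG]
  congr 1
  rw [one_div_mul_eq_div, sub_div, div_div, mul_comm]

/-- The regularized equation solved for the tangential trace of the Hessian. -/
theorem tangentialTrace_eq_of_regularized {n : ℕ} {k δ : ℝ} (hδ : 0 < δ) {f : Euc n → ℝ}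
    {x : Euc n}
    (heq : (-((gradSq n f x + δ ^ 2) ^ (1 / (2 * k) - 1 / 2))) *
      (∑ i, ∑ j, ((if i = j then (1 : ℝ) else 0) -
        pd n f i x * pd n f j x / (gradSq n f x + δ ^ 2)) * pd2 n f i j x) = 1) :
    tangentialTrace n (normalizedGrad n (fun i => pd n f i x) (gradSq n f x + δ ^ 2))
      (fun i j => pd2 n f i j x) = -(gradSq n f x + δ ^ 2) ^ (1 / 2 - 1 / (2 * k)) := by
  have hG : 0 < gradSq n f x + δ ^ 2 := by
    have := gradSq_nonneg n f x
    positivity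
  rw [tangentialTrace_normalizedGrad n _ hG]
  have h1 := rpow_mul_rpow_neg_eq_one hG k
  have h2 : (gradSq n f x + δ ^ 2) ^ (1 / (2 * k) - 1 / 2) ≠ 0 := (Real.rpow_pos_of_pos hG _).ne'
  refine mul_left_cancel₀ h2 ?_
  linear_combination -heq + h1

theorem rpow_exponent_pos {k : ℝ} (hk : 1 < k) : 0 < 1 / 2 - 1 / (2 * k) :=
  sub_pos.mpr (one_div_lt_one_div_of_lt two_pos (by linarith))

section Limit

variable {n : ℕ} {k : ℝ} {ε : ℕ → ℝ} {v : ℕ → Euc n → ℝ} {φ : Euc n → ℝ} {x : ℕ → Euc n}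
  {x₀ : Euc n} {X : ℕ → Fin (n + 1) → Fin (n + 1) → ℝ}

/-- Passage to the limit along points where the gradients of `v m` converge to that of `φ`. -/
theorem exists_limit_trace (hk : 1 < k) (hεpos : ∀ m, 0 < ε m) (hεto : Tendsto ε atTop (𝓝 0))
    (hgrad : ∀ i, Tendsto (fun m => pd n (v m) i (x m)) atTop (𝓝 (pd n φ i x₀)))
    (hX : Tendsto X atTop (𝓝 fun i j => pd2 n φ i j x₀)) :
    ∃ (η : Euc n) (s : ℕ → ℕ), ‖η‖ ≤ 1 ∧ StrictMono s ∧
      Tendsto (fun m => tangentialTrace n (normalizedGrad n (fun i => pd n (v (s m)) i (x (s m)))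
        (gradSq n (v (s m)) (x (s m)) + ε (s m) ^ 2)) (X (s m))) atTop
        (𝓝 (tangentialTrace n η fun i j => pd2 n φ i j x₀)) ∧
      Tendsto (fun m => -(gradSq n (v (s m)) (x (s m)) + ε (s m) ^ 2) ^ (1 / 2 - 1 / (2 * k)))
        atTop (𝓝 (-gradSq n φ x₀ ^ (1 / 2 - 1 / (2 * k)))) ∧
      (gradSq n φ x₀ ≠ 0 → η = normalizedGrad n (fun i => pd n φ i x₀) (gradSq n φ x₀)) := by
  have hG₀ : Tendsto (fun m => gradSq n (v m) (x m) + ε m ^ 2) atTop (𝓝 (gradSq n φ x₀)) := by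
    have h : Tendsto (fun m => gradSq n (v m) (x m)) atTop (𝓝 (gradSq n φ x₀)) :=
      tendsto_finsetSum _ fun i _ => (hgrad i).pow 2
    simpa using h.add (hεto.pow 2)
  have hG : ∀ m, 0 < gradSq n (v m) (x m) + ε m ^ 2 := fun m =>
    add_pos_of_nonneg_of_pos (gradSq_nonneg n (v m) (x m)) (pow_pos (hεpos m) 2)
  obtain ⟨η, s, hη, hs, htrace, hne⟩ := exists_limit_direction n
    (p := fun m i => pd n (v m) i (x m)) (p₀ := fun i => pd n φ i x₀) hG
    (fun m => le_add_of_nonneg_right (sq_nonneg (ε m))) (tendsto_pi_nhds.mpr hgrad) hG₀ hX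
  exact ⟨η, s, hη, hs, htrace,
    ((hG₀.comp hs.tendsto_atTop).rpow_const (Or.inr (rpow_exponent_pos hk).le)).neg, hne⟩

end Limit

theorem isViscSubsolution_of_regularized {n : ℕ} {k : ℝ} (hk : 1 < k) {Ω : Set (Euc n)}
    (hΩo : IsOpen Ω) {ε : ℕ → ℝ} (hεpos : ∀ m, 0 < ε m) (hεto : Tendsto ε atTop (𝓝 0))
    {v : ℕ → Euc n → ℝ} (hsmooth : ∀ m, ContDiffOn ℝ (⊤ : ℕ∞) (v m) Ω)
    (htr : ∀ m, ∀ x ∈ Ω, tangentialTrace n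
      (normalizedGrad n (fun i => pd n (v m) i x) (gradSq n (v m) x + ε m ^ 2))
      (fun i j => pd2 n (v m) i j x) = -(gradSq n (v m) x + ε m ^ 2) ^ (1 / 2 - 1 / (2 * k)))
    {u : Euc n → ℝ} (hconv : TendstoUniformlyOn v u atTop Ω) : IsViscSubsolution n k Ω u := by
  intro φ hφ x₀ hx₀ hmax
  obtain ⟨x, X, hgrad, hX, hcontact⟩ := exists_contact_points hΩo hsmooth hconv hφ hx₀ hmax
  obtain ⟨η, s, hη, hs, htrace, hpow, hne⟩ := exists_limit_trace hk hεpos hεto hgrad hX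
  have hle : -gradSq n φ x₀ ^ (1 / 2 - 1 / (2 * k)) ≤
      tangentialTrace n η fun i j => pd2 n φ i j x₀ := by
    refine le_of_tendsto_of_tendsto hpow htrace ?_
    filter_upwards [hs.tendsto_atTop.eventually hcontact] with m hm
    rw [← htr _ _ hm.1]
    exact hm.2 _ (norm_normalizedGrad_le_one n _ (add_pos_of_nonneg_of_pos
      (gradSq_nonneg n _ _) (pow_pos (hεpos _) 2)) (le_add_of_nonneg_right (sq_nonneg _)))
  constructor
  · intro h0
    have hg : 0 < gradSq n φ x₀ := lt_of_le_of_ne (gradSq_nonneg n φ x₀) h0.symm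
    rw [hne h0, tangentialTrace_normalizedGrad n _ hg] at hle
    rw [sqrt_rpow_eq hg.le]
    have h1 := rpow_mul_rpow_neg_eq_one hg k
    have h2 := mul_le_mul_of_nonneg_left hle (Real.rpow_nonneg hg.le (1 / (2 * k) - 1 / 2))
    linarith
  · intro h0
    rw [h0, Real.zero_rpow (rpow_exponent_pos hk).ne', neg_zero] at hle
    exact ⟨η, hη, neg_nonpos.mpr hle⟩

theorem isViscSupersolution_of_regularized {n : ℕ} {k : ℝ} (hk : 1 < k) {Ω : Set (Euc n)}
    (hΩo : IsOpen Ω) {ε : ℕ → ℝ} (hεpos : ∀ m, 0 < ε m) (hεto : Tendsto ε atTop (𝓝 0))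
    {v : ℕ → Euc n → ℝ} (hsmooth : ∀ m, ContDiffOn ℝ (⊤ : ℕ∞) (v m) Ω)
    (htr : ∀ m, ∀ x ∈ Ω, tangentialTrace n
      (normalizedGrad n (fun i => pd n (v m) i x) (gradSq n (v m) x + ε m ^ 2))
      (fun i j => pd2 n (v m) i j x) = -(gradSq n (v m) x + ε m ^ 2) ^ (1 / 2 - 1 / (2 * k)))
    {u : Euc n → ℝ} (hconv : TendstoUniformlyOn v u atTop Ω) : IsViscSupersolution n k Ω u := by
  intro φ hφ x₀ hx₀ hmin
  have hmax : IsLocalMaxOn (fun x => (-u) x - (-φ) x) Ω x₀ := by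
    have := hmin.neg
    simpa [neg_add_eq_sub] using this
  have hconv' : TendstoUniformlyOn (fun m => -v m) (-u) atTop Ω := by
    rw [Metric.tendstoUniformlyOn_iff] at hconv ⊢
    simpa only [Pi.neg_apply, dist_neg_neg] using hconv
  obtain ⟨x, Y, hgrad', hY, hcontact⟩ :=
    exists_contact_points (v := fun m => -v m) (φ := -φ) hΩo (fun m => (hsmooth m).neg) hconv'
      hφ.neg hx₀ hmax
  have hgrad : ∀ i, Tendsto (fun m => pd n (v m) i (x m)) atTop (𝓝 (pd n φ i x₀)) := fun i => by
    simpa [pd_neg] using (hgrad' i).neg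
  have hX : Tendsto (fun m => -Y m) atTop (𝓝 fun i j => pd2 n φ i j x₀) := by
    convert hY.neg using 2
    ext i j
    simp [pd2_neg]
  obtain ⟨η, s, hη, hs, htrace, hpow, hne⟩ := exists_limit_trace hk hεpos hεto hgrad hX
  have hle : (tangentialTrace n η fun i j => pd2 n φ i j x₀) ≤
      -gradSq n φ x₀ ^ (1 / 2 - 1 / (2 * k)) := by
    refine le_of_tendsto_of_tendsto htrace hpow ?_
    filter_upwards [hs.tendsto_atTop.eventually hcontact] with m hm
    rw [← htr _ _ hm.1, tangentialTrace_neg, neg_le, ← tangentialTrace_neg]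
    have hH : (-fun i j => pd2 n (v (s m)) i j (x (s m))) =
        fun i j => pd2 n (-v (s m)) i j (x (s m)) := by
      ext i j
      simp [pd2_neg]
    rw [hH]
    exact hm.2 _ (norm_normalizedGrad_le_one n _ (add_pos_of_nonneg_of_pos
      (gradSq_nonneg n _ _) (pow_pos (hεpos _) 2)) (le_add_of_nonneg_right (sq_nonneg _)))
  constructor
  · intro h0
    have hg : 0 < gradSq n φ x₀ := lt_of_le_of_ne (gradSq_nonneg n φ x₀) h0.symm
    rw [hne h0, tangentialTrace_normalizedGrad n _ hg] at hle
    rw [sqrt_rpow_eq hg.le]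
    have h1 := rpow_mul_rpow_neg_eq_one hg k
    have h2 := mul_le_mul_of_nonneg_left hle (Real.rpow_nonneg hg.le (1 / (2 * k) - 1 / 2))
    linarith
  · intro h0
    rw [h0, Real.zero_rpow (rpow_exponent_pos hk).ne', neg_zero] at hle
    exact ⟨η, hη, neg_nonneg.mpr hle⟩

/-- If smooth functions `u^ε` solve the non-divergence form regularized equation on a
bounded open `Ω` for a sequence `ε → 0` and converge uniformly on `Ω` to a continuous
function `u`, then `u` is a viscosity solution of the levelset power mean curvature flow
equation (in the test-function sense). -/
theorem stmt4 (n : ℕ) (k : ℝ) (hk : 1 < k) (Ω : Set (Euc n))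
    (hΩo : IsOpen Ω) (hΩb : IsBounded Ω)
    (ε : ℕ → ℝ) (hεpos : ∀ m, 0 < ε m) (hεto : Tendsto ε atTop (𝓝 0))
    (v : ℕ → Euc n → ℝ) (hsmooth : ∀ m, ContDiffOn ℝ (⊤ : ℕ∞) (v m) Ω)
    (heq : ∀ m, ∀ x ∈ Ω,
      (-((gradSq n (v m) x + (ε m) ^ 2) ^ (1 / (2 * k) - 1 / 2))) *
        (∑ i, ∑ j, ((if i = j then (1 : ℝ) else 0) -
          pd n (v m) i x * pd n (v m) j x / (gradSq n (v m) x + (ε m) ^ 2)) *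
          pd2 n (v m) i j x) = 1)
    (u : Euc n → ℝ) (hu : ContinuousOn u Ω)
    (hconv : TendstoUniformlyOn v u atTop Ω) :
    IsViscSolution n k Ω u := by
  have htr := fun m x hx => tangentialTrace_eq_of_regularized (hεpos m) (heq m x hx)
  exact ⟨isViscSubsolution_of_regularized hk hΩo hεpos hεto hsmooth htr hconv,
    isViscSupersolution_of_regularized hk hΩo hεpos hεto hsmooth htr hconv⟩
end
end

section
/- Let Ω ⊂ ℝ^{n+1} be bounded open, k > 1, γ > 1 + k, and let α, s > 0 satisfy β₁(α,s) > β₂(α,s), where β₁(α,s) := (2 − s + α(2 − 1/k))/(γ(2 − 1/k) + 1/k − 1) and β₂(α,s) := (α + ks)/(γ − k − 1). Let u ∈ C⁰(closure(Ω)) be a viscosity solution of the levelset power mean curvature flow equation and let u^ε ∈ C^∞(closure(Ω)) solve the regularized levelset equation. Set μ = (1 − ε^s)^k and w_ε(x, y) := μ u(x) − u^ε(y) − (ε^{−α}/γ)|x − y|^γ for x, y ∈ closure(Ω). Then for all sufficiently small ε > 0, every maximizer (x̂, ŷ) of w_ε over closure(Ω) × closure(Ω) satisfies x̂ ∈ ∂Ω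 or ŷ ∈ ∂Ω. -/
open MeasureTheory Filter Bornology
open scoped BigOperators Topology

noncomputable section

/-- The doubling function `w_ε(x, y) = (1 − ε^s)^k u(x) − u^ε(y) − (ε^{−α}/γ)|x − y|^γ`. -/
def wFun (n : ℕ) (k γ α s ε : ℝ) (u v : Euc n → ℝ) (x y : Euc n) : ℝ :=
  (1 - ε ^ s) ^ k * u x - v y - ε ^ (-α) / γ * ‖x - y‖ ^ γ

/-- Second-order necessary condition at a local minimum of a function of one variable. -/
lemma IsLocalMin.second_deriv_nonneg {g g' : ℝ → ℝ} {a c : ℝ} (h : IsLocalMin g a)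
    (hg : ∀ᶠ t in 𝓝 a, HasDerivAt g (g' t) t) (hg' : HasDerivAt g' c a) : 0 ≤ c := by
  have hd : deriv g =ᶠ[𝓝 a] g' := hg.mono fun t ht => ht.deriv
  have hc : deriv (deriv g) a = c := by rw [hd.deriv_eq, hg'.deriv]
  by_contra! hneg
  have hmax := isLocalMax_of_deriv_deriv_neg (hc ▸ hneg) h.deriv_eq_zero
    hg.self_of_nhds.continuousAt
  have hconst : g =ᶠ[𝓝 a] fun _ => g a := by
    filter_upwards [h, hmax] with t h1 h2 using le_antisymm h2 h1
  have h0 : deriv (deriv g) a = 0 := by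
    rw [hconst.deriv.deriv_eq]; simp
  linarith

section Hessian

variable {E : Type*} [NormedAddCommGroup E] [NormedSpace ℝ E]

lemma eventually_hasDerivAt_line {v : E → ℝ} {y : E} (hv : ContDiffAt ℝ 2 v y) (e : E) :
    ∀ᶠ t in 𝓝 (0 : ℝ), HasDerivAt (fun t : ℝ => v (y + t • e)) (fderiv ℝ v (y + t • e) e) t := by
  have hcont : Tendsto (fun t : ℝ => y + t • e) (𝓝 0) (𝓝 y) := by
    have : ContinuousAt (fun t : ℝ => y + t • e) 0 := by fun_prop
    simpa [ContinuousAt] using this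
  have hev : ∀ᶠ x in 𝓝 y, DifferentiableAt ℝ v x :=
    (hv.eventually (by simp)).mono fun x hx => hx.differentiableAt (by simp)
  filter_upwards [hcont.eventually hev] with t ht
  have hl : HasDerivAt (fun t : ℝ => y + t • e) e t := by
    simpa using ((hasDerivAt_id t).smul_const e).const_add y
  exact ht.hasFDerivAt.comp_hasDerivAt t hl

lemma hasDerivAt_fderiv_line {v : E → ℝ} {y : E} (hv : ContDiffAt ℝ 2 v y) (e : E) :
    HasDerivAt (fun t : ℝ => fderiv ℝ v (y + t • e) e) (fderiv ℝ (fderiv ℝ v) y e e) 0 := by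
  have hd : DifferentiableAt ℝ (fderiv ℝ v) y :=
    (hv.fderiv_right (m := 1) (by norm_num)).differentiableAt (by simp)
  have hl : HasDerivAt (fun t : ℝ => y + t • e) e 0 := by
    simpa using ((hasDerivAt_id (0 : ℝ)).smul_const e).const_add y
  have hd' : HasFDerivAt (fderiv ℝ v) (fderiv ℝ (fderiv ℝ v) y) (y + (0 : ℝ) • e) := by
    simpa using hd.hasFDerivAt
  have := hd'.comp_hasDerivAt (0 : ℝ) hl
  simpa using this.clm_apply (hasDerivAt_const (0 : ℝ) e)

end Hessian

section Touching

variable {E : Type*} [NormedAddCommGroup E] [InnerProductSpace ℝ E]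

lemma norm_sub_smul_rpow (z e : E) (t γ : ℝ) :
    ‖z - t • e‖ ^ γ = (‖z‖ ^ 2 - 2 * t * inner ℝ z e + t ^ 2 * ‖e‖ ^ 2) ^ (γ / 2) := by
  have h : ‖z‖ ^ 2 - 2 * t * inner ℝ z e + t ^ 2 * ‖e‖ ^ 2 = ‖z - t • e‖ ^ 2 := by
    rw [norm_sub_sq_real, inner_smul_right, norm_smul, mul_pow, Real.norm_eq_abs, sq_abs]; ring
  rw [h, ← Real.rpow_natCast, ← Real.rpow_mul (norm_nonneg _)]
  congr 1; push_cast; ring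

/-- First- and second-order conditions when `v` is touched from below by
`-(C / γ) * ‖x - ·‖ ^ γ`. -/
lemma touching_conditions {v : E → ℝ} {x y : E} {C γ : ℝ} (hC : 0 < C) (hγ : 2 < γ)
    (hv : ContDiffAt ℝ 2 v y)
    (hmin : IsLocalMin (fun y' => v y' + C / γ * ‖x - y'‖ ^ γ) y) (e : E) :
    -((γ - 1) * C * ‖x - y‖ ^ (γ - 2)) * ‖e‖ ^ 2 ≤ fderiv ℝ (fderiv ℝ v) y e e ∧
      (x - y ≠ 0 → fderiv ℝ v y e = C * ‖x - y‖ ^ (γ - 2) * inner ℝ (x - y) e) := by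
  have hcont : Tendsto (fun t : ℝ => y + t • e) (𝓝 0) (𝓝 y) := by
    have : ContinuousAt (fun t : ℝ => y + t • e) 0 := by fun_prop
    simpa [ContinuousAt] using this
  have hline : ∀ᶠ t in 𝓝 (0 : ℝ),
      v y + C / γ * ‖x - y‖ ^ γ ≤ v (y + t • e) + C / γ * ‖x - y - t • e‖ ^ γ := by
    filter_upwards [hcont.eventually hmin] with t ht
    rwa [← sub_sub] at ht
  have hv1 := eventually_hasDerivAt_line hv e
  have hv2 := hasDerivAt_fderiv_line hv e
  by_cases hz : x - y = 0
  · refine ⟨?_, fun h => absurd hz h⟩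
    rw [hz, norm_zero, Real.zero_rpow (by linarith)]
    rw [hz, norm_zero, Real.zero_rpow (by linarith)] at hline
    simp only [mul_zero, neg_zero, zero_mul]
    refine le_of_forall_pos_le_add fun δ hδ => ?_
    have hsmall : ∀ᶠ t in 𝓝 (0 : ℝ), C / γ * ‖e‖ ^ γ * |t| ^ (γ - 2) < δ / 2 := by
      have hct : ContinuousAt (fun t : ℝ => C / γ * ‖e‖ ^ γ * |t| ^ (γ - 2)) 0 := by
        refine continuousAt_const.mul (ContinuousAt.rpow_const continuous_abs.continuousAt ?_)
        right; linarith
      refine hct.eventually_lt continuousAt_const ?_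
      simp only [abs_zero]
      rw [Real.zero_rpow (by linarith)]; linarith
    have hm : IsLocalMin (fun t : ℝ => v (y + t • e) + δ / 2 * t ^ 2) 0 := by
      filter_upwards [hline, hsmall] with t ht hs
      have h1 : ‖(0 : E) - t • e‖ ^ γ = ‖e‖ ^ γ * |t| ^ (γ - 2) * t ^ 2 := by
        rw [zero_sub, norm_neg, norm_smul, Real.norm_eq_abs,
          Real.mul_rpow (abs_nonneg _) (norm_nonneg _), ← sq_abs t]
        rcases eq_or_ne t 0 with rfl | h0
        · simp [Real.zero_rpow (show γ ≠ 0 by linarith)]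
        · rw [mul_assoc, ← Real.rpow_natCast |t| 2, ← Real.rpow_add (abs_pos.2 h0)]
          norm_num [mul_comm]
      rw [h1] at ht
      have h2 := mul_le_mul_of_nonneg_right hs.le (sq_nonneg t)
      simp only [zero_smul, add_zero]
      nlinarith
    have hq : ∀ t : ℝ, HasDerivAt (fun t : ℝ => δ / 2 * t ^ 2) (δ * t) t := fun t => by
      exact ((hasDerivAt_pow 2 t).const_mul (δ / 2)).congr_deriv (by push_cast; ring)
    have hq' : HasDerivAt (fun t : ℝ => δ * t) δ 0 := by
      simpa using (hasDerivAt_id (0 : ℝ)).const_mul δ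
    exact hm.second_deriv_nonneg (hv1.mono fun t ht => ht.add (hq t)) (hv2.add hq')
  · have hzpos : 0 < ‖x - y‖ := norm_pos_iff.2 hz
    generalize hzz : x - y = z at *
    set b := inner ℝ z e with hb
    set q : ℝ → ℝ := fun t => ‖z‖ ^ 2 - 2 * t * b + t ^ 2 * ‖e‖ ^ 2 with hqdef
    have hq : ∀ t, HasDerivAt q (-2 * b + 2 * t * ‖e‖ ^ 2) t := fun t => by
      have h1 : HasDerivAt (fun t : ℝ => 2 * t * b) (2 * b) t := by
        simpa using ((hasDerivAt_id t).const_mul 2).mul_const b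
      have h2 : HasDerivAt (fun t : ℝ => t ^ 2 * ‖e‖ ^ 2) (2 * t * ‖e‖ ^ 2) t := by
        simpa using (hasDerivAt_pow 2 t).mul_const (‖e‖ ^ 2)
      exact ((h1.const_sub (‖z‖ ^ 2)).add h2).congr_deriv (by ring)
    have hq0 : q 0 = ‖z‖ ^ 2 := by simp [hqdef]
    have hqpos : ∀ᶠ t in 𝓝 (0 : ℝ), 0 < q t :=
      continuousAt_const.eventually_lt (hq 0).continuousAt (by rw [hq0]; positivity)
    have hm : IsLocalMin (fun t : ℝ => v (y + t • e) + C / γ * q t ^ (γ / 2)) 0 := by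
      filter_upwards [hline] with t ht
      rw [norm_sub_smul_rpow] at ht
      have h0 := norm_sub_smul_rpow z e 0 γ
      simp only [zero_smul, sub_zero] at h0
      simp only [zero_smul, add_zero]
      rw [h0] at ht
      exact ht
    set g' : ℝ → ℝ := fun t => fderiv ℝ v (y + t • e) e +
      C / γ * ((-2 * b + 2 * t * ‖e‖ ^ 2) * (γ / 2) * q t ^ (γ / 2 - 1)) with hg'
    have hd1 : ∀ᶠ t in 𝓝 (0 : ℝ),
        HasDerivAt (fun t : ℝ => v (y + t • e) + C / γ * q t ^ (γ / 2)) (g' t) t := by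
      filter_upwards [hv1, hqpos] with t ht hpos
      exact ht.add (((hq t).rpow_const (Or.inl hpos.ne')).const_mul _)
    have hlin : HasDerivAt (fun t : ℝ => -2 * b + 2 * t * ‖e‖ ^ 2) (2 * ‖e‖ ^ 2) 0 := by
      simpa using (((hasDerivAt_id (0 : ℝ)).const_mul 2).mul_const (‖e‖ ^ 2)).const_add (-2 * b)
    have hd2 := hv2.add ((((hlin.mul_const (γ / 2)).mul
      ((hq 0).rpow_const (p := γ / 2 - 1) (Or.inl hqpos.self_of_nhds.ne')))).const_mul (C / γ))
    have hnn := hm.second_deriv_nonneg hd1 hd2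
    have hz1 : (‖z‖ ^ 2) ^ (γ / 2 - 1) = ‖z‖ ^ (γ - 2) := by
      rw [← Real.rpow_natCast, ← Real.rpow_mul (norm_nonneg _)]
      congr 1; push_cast; ring
    have hz2 : (‖z‖ ^ 2) ^ (γ / 2 - 1 - 1) * ‖z‖ ^ 2 = ‖z‖ ^ (γ - 2) := by
      rw [Real.rpow_sub_one (by positivity), hz1]; field_simp
    constructor
    · have hcs : b ^ 2 ≤ ‖z‖ ^ 2 * ‖e‖ ^ 2 := by
        rw [← mul_pow, ← sq_abs]
        exact pow_le_pow_left₀ (abs_nonneg _) (abs_real_inner_le_norm z e) 2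
      rw [hq0, hz1] at hnn
      set w := (‖z‖ ^ 2) ^ (γ / 2 - 1 - 1) with hw
      have hwpos : 0 < w := by positivity
      have h3 : w * b ^ 2 ≤ ‖z‖ ^ (γ - 2) * ‖e‖ ^ 2 := by
        rw [← hz2, mul_assoc]; exact mul_le_mul_of_nonneg_left hcs hwpos.le
      have h4 := mul_le_mul_of_nonneg_left h3 (show 0 ≤ C * (γ - 2) by nlinarith)
      have h5 : fderiv ℝ (fderiv ℝ v) y e e +
          (C * ‖z‖ ^ (γ - 2) * ‖e‖ ^ 2 + C * (γ - 2) * (w * b ^ 2)) =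
          fderiv ℝ (fderiv ℝ v) y e e + C / γ * (2 * ‖e‖ ^ 2 * (γ / 2) * ‖z‖ ^ (γ - 2) +
            (-2 * b + 2 * 0 * ‖e‖ ^ 2) * (γ / 2) *
              ((-2 * b + 2 * 0 * ‖e‖ ^ 2) * (γ / 2 - 1) * w)) := by
        field_simp; ring
      rw [← h5] at hnn
      nlinarith
    · intro _
      have h0 := hm.hasDerivAt_eq_zero hd1.self_of_nhds
      simp only [hg', hq0, hz1, zero_smul, add_zero] at h0
      have h6 : C / γ * ((-2 * b + 2 * 0 * ‖e‖ ^ 2) * (γ / 2) * ‖z‖ ^ (γ - 2)) =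
          -(C * ‖z‖ ^ (γ - 2) * b) := by
        field_simp; ring
      linarith

end Touching

section Coordinates

variable {n : ℕ}

/-- The gradient of `v` at `x` as a vector of partial derivatives. -/
def gradVec (n : ℕ) (v : Euc n → ℝ) (x : Euc n) : Euc n :=
  WithLp.toLp 2 fun i => pd n v i x

lemma norm_gradVec_sq (v : Euc n → ℝ) (x : Euc n) : ‖gradVec n v x‖ ^ 2 = gradSq n v x := by
  simp [EuclideanSpace.norm_sq_eq, gradVec, gradSq]

lemma sum_smul_single (e : Euc n) : ∑ i, e i • EuclideanSpace.single i (1 : ℝ) = e := by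
  have := (EuclideanSpace.basisFun (Fin (n + 1)) ℝ).sum_repr e
  simpa using this

lemma bilin_apply_eq_sum (B : Euc n →L[ℝ] Euc n →L[ℝ] ℝ) (e f : Euc n) :
    B e f = ∑ i, ∑ j, e i * f j *
      B (EuclideanSpace.single i 1) (EuclideanSpace.single j 1) := by
  conv_lhs => rw [← sum_smul_single e, ← sum_smul_single f]
  simp only [map_sum, map_smul, _root_.sum_apply, _root_.smul_apply,
    smul_eq_mul, Finset.mul_sum]
  rw [Finset.sum_comm]
  refine Finset.sum_congr rfl fun i _ => Finset.sum_congr rfl fun j _ => ?_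
  ring

lemma pd2_eq {v : Euc n → ℝ} {x : Euc n} (hv : ContDiffAt ℝ 2 v x) (i j : Fin (n + 1)) :
    pd2 n v i j x = fderiv ℝ (fderiv ℝ v) x
      (EuclideanSpace.single i 1) (EuclideanSpace.single j 1) := by
  have hd : DifferentiableAt ℝ (fderiv ℝ v) x :=
    (hv.fderiv_right (m := 1) (by norm_num)).differentiableAt (by simp)
  have h := hd.hasFDerivAt.clm_apply
    (hasFDerivAt_const (EuclideanSpace.single j (1 : ℝ) : Euc n) x)
  unfold pd2
  change fderiv ℝ (fun y => fderiv ℝ v y (EuclideanSpace.single j 1)) x _ = _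
  rw [h.fderiv]
  simp

/-- Contraction of a bilinear form with `δ - p ⊗ p / c`. -/
lemma sum_delta_sub_mul (B : Euc n →L[ℝ] Euc n →L[ℝ] ℝ) (p : Euc n) (c : ℝ) :
    ∑ i, ∑ j, ((if i = j then (1 : ℝ) else 0) - p i * p j / c) *
        B (EuclideanSpace.single i 1) (EuclideanSpace.single j 1) =
      (∑ i, B (EuclideanSpace.single i 1) (EuclideanSpace.single i 1)) - B p p / c := by
  rw [bilin_apply_eq_sum B p p]
  simp only [sub_mul, Finset.sum_sub_distrib, Finset.sum_div, ite_mul, one_mul, zero_mul,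
    Finset.sum_ite_eq, Finset.mem_univ, if_true]
  congr 1
  refine Finset.sum_congr rfl fun i _ => Finset.sum_congr rfl fun j _ => ?_
  ring

/-- A lower bound for a quadratic form bounds the trace of its tangential part. -/
lemma neg_le_trace_sub {B : Euc n →L[ℝ] Euc n →L[ℝ] ℝ} {M : ℝ} (hM : 0 ≤ M)
    (hB : ∀ e, -M * ‖e‖ ^ 2 ≤ B e e) (p : Euc n) :
    -((n + 1) * M) ≤
      (∑ i, B (EuclideanSpace.single i 1) (EuclideanSpace.single i 1)) - B p p / ‖p‖ ^ 2 := by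
  set P := ‖p‖ ^ 2 with hP
  set f : Fin (n + 1) → Euc n := fun m => EuclideanSpace.single m 1 - (p m / P) • p with hf
  have hcoef : ∀ a : ℝ, P / P * (a / P) = a / P := fun a => by
    rcases eq_or_ne P 0 with h | h
    · simp [h]
    · field_simp
  have hnorm : ∀ m, ‖f m‖ ^ 2 ≤ 1 := fun m => by
    have h1 : ‖f m‖ ^ 2 = 1 - p m ^ 2 / P := by
      simp only [hf]
      rw [norm_sub_sq_real, inner_smul_right, norm_smul, mul_pow, ← hP,
        EuclideanSpace.inner_single_left]
      simp only [PiLp.norm_single, norm_one, map_one, one_mul, Real.norm_eq_abs, sq_abs]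
      have := hcoef (p m ^ 2)
      have h2 : (p m / P) ^ 2 * P = P / P * (p m ^ 2 / P) := by ring
      rw [h2, this]; ring
    rw [h1]
    have : 0 ≤ p m ^ 2 / P := by positivity
    linarith
  have hlow : ∀ m, -M ≤ B (f m) (f m) := fun m => by
    have := hB (f m)
    nlinarith [hnorm m]
  have hsum : ∑ m, B (f m) (f m) =
      (∑ i, B (EuclideanSpace.single i 1) (EuclideanSpace.single i 1)) - B p p / P := by
    have h1 : ∑ m, p m * B (EuclideanSpace.single m 1) p = B p p := by
      have := congrArg (fun e => B e p) (sum_smul_single p)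
      simpa only [map_sum, map_smul, _root_.sum_apply, _root_.smul_apply, smul_eq_mul] using this
    have h2 : ∑ m, p m * B p (EuclideanSpace.single m 1) = B p p := by
      have := congrArg (fun e => B p e) (sum_smul_single p)
      simpa only [map_sum, map_smul, smul_eq_mul] using this
    have h3 : ∑ m, p m ^ 2 = P := by simp [hP, EuclideanSpace.norm_sq_eq]
    have h4 : ∀ m, B (f m) (f m) = B (EuclideanSpace.single m 1) (EuclideanSpace.single m 1)
        - p m * B (EuclideanSpace.single m 1) p / P
        - p m * B p (EuclideanSpace.single m 1) / P + p m ^ 2 * (B p p / P ^ 2) := fun m => by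
      simp only [hf, map_sub, map_smul, _root_.sub_apply,
        _root_.smul_apply, smul_eq_mul]
      ring
    simp only [h4, Finset.sum_add_distrib, Finset.sum_sub_distrib, ← Finset.sum_div,
      ← Finset.sum_mul, h1, h2, h3]
    have := hcoef (B p p)
    have h5 : P * (B p p / P ^ 2) = P / P * (B p p / P) := by ring
    rw [h5, this]; ring
  rw [← hsum]
  calc -((n + 1) * M) = ∑ _m : Fin (n + 1), -M := by simp
    _ ≤ _ := Finset.sum_le_sum fun m _ => hlow m

/-- The regularized equation in nondivergence form. -/
lemma SolvesReg.nondivergence {k ε : ℝ} {Ω : Set (Euc n)} {v : Euc n → ℝ} {y : Euc n}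
    (h : SolvesReg n k ε Ω v) (hε : 0 < ε) (hy : y ∈ Ω) (hv : ContDiffAt ℝ 2 v y) :
    (∑ i, fderiv ℝ (fderiv ℝ v) y (EuclideanSpace.single i 1) (EuclideanSpace.single i 1)) -
      fderiv ℝ (fderiv ℝ v) y (gradVec n v y) (gradVec n v y) / (ε ^ 2 + gradSq n v y) =
      -((ε ^ 2 + gradSq n v y) ^ ((1 - 1 / k) / 2)) := by
  set B := fderiv ℝ (fderiv ℝ v) y with hB
  set Q := ε ^ 2 + gradSq n v y with hQ
  have hQpos : 0 < Q := by
    have : 0 ≤ gradSq n v y := Finset.sum_nonneg fun i _ => sq_nonneg _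
    positivity
  have hdp : ∀ j, DifferentiableAt ℝ (fun x => pd n v j x) y := fun j =>
    ((hv.fderiv_right (m := 1) (by norm_num)).differentiableAt (by simp)).clm_apply
      (differentiableAt_const _)
  have hpd : ∀ i j, fderiv ℝ (fun x => pd n v j x) y (EuclideanSpace.single i 1) =
      B (EuclideanSpace.single i 1) (EuclideanSpace.single j 1) := fun i j => pd2_eq hv i j
  have hterm : ∀ i, pd n (fun y => pd n v i y / Real.sqrt (ε ^ 2 + gradSq n v y)) i y =
      (B (EuclideanSpace.single i 1) (EuclideanSpace.single i 1) -
        (∑ j, pd n v i y * pd n v j y *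
          B (EuclideanSpace.single i 1) (EuclideanSpace.single j 1)) / Q) / Real.sqrt Q := by
    intro i
    have hG : HasFDerivAt (fun x => ε ^ 2 + gradSq n v x)
        (∑ j, (2 * pd n v j y) • fderiv ℝ (fun x => pd n v j x) y) y := by
      refine HasFDerivAt.const_add _ ?_
      unfold gradSq
      refine HasFDerivAt.fun_sum fun j _ => ?_
      simpa using (hdp j).hasFDerivAt.pow 2
    have hS := hG.sqrt hQpos.ne'
    have hsq : Real.sqrt Q ≠ 0 := (Real.sqrt_pos.2 hQpos).ne'
    have hD := (hdp i).hasFDerivAt.mul ((hasDerivAt_inv hsq).comp_hasFDerivAt y hS)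
    have hss : Real.sqrt Q ^ 2 = Q := Real.sq_sqrt hQpos.le
    have hfd : fderiv ℝ (fun x => pd n v i x / Real.sqrt (ε ^ 2 + gradSq n v x)) y = _ :=
      hD.fderiv
    have hfac : ∑ j, pd n v i y * pd n v j y *
        B (EuclideanSpace.single i 1) (EuclideanSpace.single j 1) =
        pd n v i y * ∑ j, pd n v j y *
          B (EuclideanSpace.single i 1) (EuclideanSpace.single j 1) := by
      rw [Finset.mul_sum]
      exact Finset.sum_congr rfl fun j _ => by ring
    rw [pd, hfd, hfac]
    simp only [_root_.add_apply, _root_.smul_apply, _root_.sum_apply, smul_eq_mul, hpd, mul_assoc,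
      ← Finset.mul_sum, Function.comp_apply]
    rw [← hQ, hss]
    field_simp
    ring
  have hsum := h y hy
  simp only [hterm] at hsum
  rw [← Finset.sum_div, Finset.sum_sub_distrib, ← Finset.sum_div] at hsum
  have hpp : ∑ i, ∑ j, pd n v i y * pd n v j y *
      B (EuclideanSpace.single i 1) (EuclideanSpace.single j 1) =
      B (gradVec n v y) (gradVec n v y) := by
    rw [bilin_apply_eq_sum B (gradVec n v y)]; rfl
  rw [hpp, div_eq_iff (Real.sqrt_pos.2 hQpos).ne'] at hsum
  rw [hsum, neg_mul, Real.sqrt_eq_rpow, ← Real.rpow_add hQpos]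
  congr 2
  ring

end Coordinates

section TestFunctions

variable {n : ℕ}

/-- A germ of a smooth function extends to a globally smooth function. -/
lemma exists_contDiff_eventuallyEq {f : Euc n → ℝ} {x : Euc n}
    (h : ∀ᶠ y in 𝓝 x, ContDiffAt ℝ (⊤ : ℕ∞) f y) :
    ∃ φ : Euc n → ℝ, ContDiff ℝ (⊤ : ℕ∞) φ ∧ φ =ᶠ[𝓝 x] f := by
  obtain ⟨r, hr, hball⟩ := Metric.nhds_basis_closedBall.mem_iff.1 h
  let χ : ContDiffBump x := ⟨r / 2, r, by positivity, by linarith⟩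
  refine ⟨fun y => χ y * f y, contDiff_iff_contDiffAt.2 fun y => ?_, ?_⟩
  · by_cases hy : y ∈ Metric.closedBall x r
    · exact χ.contDiffAt.mul (hball hy)
    · have h0 : (fun y => χ y * f y) =ᶠ[𝓝 y] fun _ => 0 := by
        filter_upwards [Metric.isClosed_closedBall.isOpen_compl.mem_nhds hy] with w hw
        have : r ≤ dist w x := (not_le.1 fun h => hw (Metric.mem_closedBall.2 h)).le
        rw [χ.zero_of_le_dist this, zero_mul]
      exact contDiffAt_const.congr_of_eventuallyEq h0
  · filter_upwards [χ.eventuallyEq_one] with y hy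
    simp [hy]

lemma pd_congr {f g : Euc n → ℝ} {x : Euc n} (h : f =ᶠ[𝓝 x] g) (i : Fin (n + 1)) :
    pd n f i =ᶠ[𝓝 x] pd n g i := by
  filter_upwards [h.fderiv (𝕜 := ℝ)] with y hy
  rw [pd, pd, hy]

lemma pd_const_mul_comp_sub (v : Euc n → ℝ) (c : ℝ) (z : Euc n) (i : Fin (n + 1)) :
    pd n (fun x => c * v (x - z)) i = fun x => c * pd n v i (x - z) := by
  funext x
  have h := fderiv_const_smul_field (𝕜 := ℝ) (f := fun x => v (x - z)) c
  change fderiv ℝ (c • fun x => v (x - z)) x _ = _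
  rw [h, Pi.smul_apply, fderiv_comp_sub]
  rfl

/-- The subsolution inequality at a point touched by a translated and rescaled smooth function. -/
lemma IsViscSubsolution.translate {k a : ℝ} {Ω : Set (Euc n)} {u v : Euc n → ℝ} {x z : Euc n}
    (hu : IsViscSubsolution n k Ω u) (hk : 1 < k) (ha : 0 < a) (hx : x ∈ Ω)
    (hv : ∀ᶠ y in 𝓝 (x - z), ContDiffAt ℝ (⊤ : ℕ∞) v y)
    (hmax : IsLocalMax (fun x' => a ^ k * u x' - v (x' - z)) x)
    (hg : 0 < gradSq n v (x - z)) :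
    -((∑ i, fderiv ℝ (fderiv ℝ v) (x - z)
        (EuclideanSpace.single i 1) (EuclideanSpace.single i 1)) -
      fderiv ℝ (fderiv ℝ v) (x - z) (gradVec n v (x - z)) (gradVec n v (x - z)) /
        gradSq n v (x - z)) ≤ a * Real.sqrt (gradSq n v (x - z)) ^ (1 - 1 / k) := by
  have hμ : 0 < a ^ k := Real.rpow_pos_of_pos ha k
  set c := (a ^ k)⁻¹ with hc
  have hcpos : 0 < c := inv_pos.2 hμ
  set f : Euc n → ℝ := fun x' => c * v (x' - z) with hf
  have htr : Tendsto (fun x' : Euc n => x' - z) (𝓝 x) (𝓝 (x - z)) :=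
    (continuous_id.sub continuous_const).continuousAt
  have hfs : ∀ᶠ y in 𝓝 x, ContDiffAt ℝ (⊤ : ℕ∞) f y := by
    filter_upwards [htr.eventually hv] with y hy
    exact contDiffAt_const.mul (hy.comp y (contDiffAt_id.sub contDiffAt_const))
  obtain ⟨φ, hφ, hφf⟩ := exists_contDiff_eventuallyEq hfs
  have hφmax : IsLocalMaxOn (fun x' => u x' - φ x') Ω x := by
    refine Filter.Eventually.filter_mono nhdsWithin_le_nhds ?_
    filter_upwards [hmax, hφf] with y h1 h2
    rw [h2, hφf.self_of_nhds]
    have e : ∀ w, u w - f w = c * (a ^ k * u w - v (w - z)) := fun w => by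
      simp only [hf, hc]; field_simp
    rw [e, e]
    exact mul_le_mul_of_nonneg_left h1 hcpos.le
  have hpd : ∀ i, pd n φ i x = c * gradVec n v (x - z) i := fun i => by
    rw [(pd_congr hφf i).self_of_nhds, pd_const_mul_comp_sub]; rfl
  have hv2 : ContDiffAt ℝ 2 v (x - z) := hv.self_of_nhds.of_le (WithTop.coe_le_coe.2 le_top)
  have hpd2 : ∀ i j, pd2 n φ i j x = c * fderiv ℝ (fderiv ℝ v) (x - z)
      (EuclideanSpace.single i 1) (EuclideanSpace.single j 1) := fun i j => by
    rw [pd2, (pd_congr (pd_congr hφf j) i).self_of_nhds, pd_const_mul_comp_sub,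
      pd_const_mul_comp_sub, ← pd2_eq hv2]
    rfl
  set P := gradSq n v (x - z) with hP
  have hgr : gradSq n φ x = c ^ 2 * P := by
    simp only [gradSq, hpd, mul_pow, ← Finset.mul_sum, hP]; rfl
  have hineq := (hu φ hφ.contDiffOn x hx hφmax).1 (by rw [hgr]; positivity)
  set B := fderiv ℝ (fderiv ℝ v) (x - z) with hB
  set p := gradVec n v (x - z) with hp
  have hsum : ∑ i, ∑ j, ((if i = j then (1 : ℝ) else 0) -
      pd n φ i x * pd n φ j x / gradSq n φ x) * pd2 n φ i j x =
      c * ((∑ i, B (EuclideanSpace.single i 1) (EuclideanSpace.single i 1)) - B p p / P) := by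
    rw [← sum_delta_sub_mul, Finset.mul_sum]
    refine Finset.sum_congr rfl fun i _ => ?_
    rw [Finset.mul_sum]
    refine Finset.sum_congr rfl fun j _ => ?_
    rw [hpd, hpd, hpd2, hgr]
    field_simp
  rw [hsum, hgr, Real.sqrt_mul (sq_nonneg c), Real.sqrt_sq hcpos.le,
    Real.mul_rpow hcpos.le (Real.sqrt_nonneg P)] at hineq
  set T := (∑ i, B (EuclideanSpace.single i 1) (EuclideanSpace.single i 1)) - B p p / P
  have hR : 0 < Real.sqrt P := Real.sqrt_pos.2 hg
  have hcc : c ^ (1 / k - 1) * c = a⁻¹ := by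
    rw [← Real.rpow_add_one hcpos.ne', hc, ← Real.rpow_neg ha.le, ← Real.rpow_mul ha.le,
      ← Real.rpow_neg_one]
    congr 1
    field_simp; ring
  have hRR : Real.sqrt P ^ (1 / k - 1) = (Real.sqrt P ^ (1 - 1 / k))⁻¹ := by
    rw [← Real.rpow_neg hR.le]; congr 1; ring
  have hw : 0 < Real.sqrt P ^ (1 - 1 / k) := Real.rpow_pos_of_pos hR _
  have e : -(c ^ (1 / k - 1) * Real.sqrt P ^ (1 / k - 1)) * (c * T) =
      -T / (a * Real.sqrt P ^ (1 - 1 / k)) := by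
    rw [show -(c ^ (1 / k - 1) * Real.sqrt P ^ (1 / k - 1)) * (c * T) =
      -T * (c ^ (1 / k - 1) * c) * Real.sqrt P ^ (1 / k - 1) by ring, hcc, hRR]
    field_simp
  rw [e, div_le_one (by positivity)] at hineq
  exact hineq

end TestFunctions

/-- The two power estimates for `r = |x̂ - ŷ|` are incompatible for small `ε`. -/
lemma exists_pos_forall_estimates_false {k γ α s C : ℝ} (hk : 1 < k) (hγ : 1 + k < γ)
    (hs : 0 < s) (hC : 0 < C)
    (hβ : (α + k * s) / (γ - k - 1) <
      (2 - s + α * (2 - 1 / k)) / (γ * (2 - 1 / k) + 1 / k - 1)) :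
    ∃ ε₀ : ℝ, 0 < ε₀ ∧ ∀ ε r : ℝ, 0 < ε → ε < ε₀ → 0 < r →
      (ε ^ (-α) * r ^ (γ - 1)) ^ (1 - 1 / k) ≤ C * ((γ - 1) * ε ^ (-α) * r ^ (γ - 2)) →
      ε ^ s * (ε ^ (-α) * r ^ (γ - 1)) ^ (1 - 1 / k) * (ε ^ (-α) * r ^ (γ - 1)) ^ (2 : ℝ) ≤
        ε ^ (2 : ℝ) * ((γ - 1) * ε ^ (-α) * r ^ (γ - 2)) → False := by
  have hk1 : 0 < 1 / k := by positivity
  have hk2 : 1 / k < 1 := by rw [div_lt_one (by linarith)]; exact hk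
  set κ := 1 / k with hκ
  have hkκ : k * κ = 1 := by rw [hκ]; field_simp
  set D := γ * (2 - κ) + κ - 1 with hD
  set N := 2 - s + α * (2 - κ) with hN
  have hDpos : 0 < D := by nlinarith
  have hG : 0 < γ - k - 1 := by linarith
  rw [div_lt_div_iff₀ hG hDpos] at hβ
  have hgap : 0 < N * (γ - k - 1) - α * D := by
    have : 0 < k * s * D := by positivity
    nlinarith
  set K1 := k * Real.log (C * (γ - 1)) with hK1
  set K2 := Real.log (γ - 1) with hK2
  refine ⟨Real.exp (-(K1 * D + (γ - k - 1) * K2) / (N * (γ - k - 1) - α * D)),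
    Real.exp_pos _, fun ε r hε hlt hr h1 h2 => ?_⟩
  have hγ1 : 0 < γ - 1 := by linarith
  have hL := (Real.log_lt_iff_lt_exp hε).2 hlt
  rw [lt_div_iff₀ hgap] at hL
  have l1 := Real.log_le_log (by positivity) h1
  have l2 := Real.log_le_log (by positivity) h2
  have hA : 0 < ε ^ (-α) := Real.rpow_pos_of_pos hε _
  have hR : 0 < r ^ (γ - 1) := Real.rpow_pos_of_pos hr _
  have hR2 : 0 < r ^ (γ - 2) := Real.rpow_pos_of_pos hr _
  have hAR : 0 < ε ^ (-α) * r ^ (γ - 1) := by positivity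
  have hlogR : Real.log (ε ^ (-α) * r ^ (γ - 1)) =
      -α * Real.log ε + (γ - 1) * Real.log r := by
    rw [Real.log_mul hA.ne' hR.ne', Real.log_rpow hε, Real.log_rpow hr]
  have hlogM : Real.log ((γ - 1) * ε ^ (-α) * r ^ (γ - 2)) =
      K2 + -α * Real.log ε + (γ - 2) * Real.log r := by
    rw [Real.log_mul (by positivity) hR2.ne', Real.log_mul hγ1.ne' hA.ne', Real.log_rpow hε,
      Real.log_rpow hr]
  rw [Real.log_rpow hAR, Real.log_mul hC.ne' (by positivity), hlogR, hlogM] at l1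
  have hM : 0 < (γ - 1) * ε ^ (-α) * r ^ (γ - 2) := by positivity
  rw [Real.log_mul (by positivity) (by positivity), Real.log_mul (by positivity) (by positivity),
    Real.log_rpow hAR, Real.log_rpow hAR, Real.log_rpow hε, hlogR,
    Real.log_mul (by positivity) hM.ne', Real.log_rpow hε, hlogM] at l2
  have hK1' : K1 = k * (Real.log C + K2) := by rw [hK1, Real.log_mul hC.ne' hγ1.ne']
  set L := Real.log ε
  set ρ := Real.log r
  have m1 : α * L ≤ K1 + (γ - k - 1) * ρ := by
    have h := mul_le_mul_of_nonneg_left l1 (show 0 ≤ k by linarith)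
    have e : k * ((1 - κ) * (-α * L + (γ - 1) * ρ)) =
        (k - k * κ) * (-α * L + (γ - 1) * ρ) := by ring
    rw [e, hkκ] at h
    rw [hK1']
    linarith
  have m2 : D * ρ ≤ K2 + N * L := by
    rw [hD, hN]; linarith
  have m3 := mul_le_mul_of_nonneg_left m1 hDpos.le
  have m4 := mul_le_mul_of_nonneg_left m2 hG.le
  nlinarith

/-- The estimates satisfied by `r = |x̂ - ŷ|` at an interior maximum point. -/
lemma interior_max_estimates {n : ℕ} {k γ α s ε : ℝ} (hk : 1 < k) (hγ : 1 + k < γ)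
    (hs : 0 < s) (hε : 0 < ε) (hε1 : ε < 1) {Ω : Set (Euc n)} (hΩ : IsOpen Ω)
    {u v : Euc n → ℝ} (hu : IsViscSubsolution n k Ω u) (hv : ContDiffOn ℝ (⊤ : ℕ∞) v Ω)
    (hreg : SolvesReg n k ε Ω v) {x y : Euc n} (hx : x ∈ Ω) (hy : y ∈ Ω)
    (hmax : ∀ x' ∈ Ω, ∀ y' ∈ Ω, wFun n k γ α s ε u v x' y' ≤ wFun n k γ α s ε u v x y) :
    0 < ‖x - y‖ ∧
      (ε ^ (-α) * ‖x - y‖ ^ (γ - 1)) ^ (1 - 1 / k) ≤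
        (n + 2) * ((γ - 1) * ε ^ (-α) * ‖x - y‖ ^ (γ - 2)) ∧
      ε ^ s * (ε ^ (-α) * ‖x - y‖ ^ (γ - 1)) ^ (1 - 1 / k) *
          (ε ^ (-α) * ‖x - y‖ ^ (γ - 1)) ^ (2 : ℝ) ≤
        ε ^ (2 : ℝ) * ((γ - 1) * ε ^ (-α) * ‖x - y‖ ^ (γ - 2)) := by
  have hA : 0 < ε ^ (-α) := Real.rpow_pos_of_pos hε _
  have hκ : 0 < 1 - 1 / k := by
    have : 1 / k < 1 := by rw [div_lt_one (by linarith)]; exact hk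
    linarith
  have hvs : ∀ w ∈ Ω, ContDiffAt ℝ (⊤ : ℕ∞) v w := fun w hw => hv.contDiffAt (hΩ.mem_nhds hw)
  have hv2 : ContDiffAt ℝ 2 v y := (hvs y hy).of_le (WithTop.coe_le_coe.2 le_top)
  have hmin : IsLocalMin (fun y' => v y' + ε ^ (-α) / γ * ‖x - y'‖ ^ γ) y := by
    filter_upwards [hΩ.mem_nhds hy] with y' hy'
    have := hmax x hx y' hy'
    simp only [wFun] at this
    linarith
  have htouch := touching_conditions hA (show 2 < γ by linarith) hv2 hmin
  set B := fderiv ℝ (fderiv ℝ v) y with hB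
  set M := (γ - 1) * ε ^ (-α) * ‖x - y‖ ^ (γ - 2) with hM
  set p := gradVec n v y with hp
  set P := gradSq n v y with hP
  have hpP : ‖p‖ ^ 2 = P := norm_gradVec_sq v y
  have hP0 : 0 ≤ P := hpP ▸ sq_nonneg _
  have hM0 : 0 ≤ M := by
    have : 0 < γ - 1 := by linarith
    positivity
  have hlow : ∀ e, -M * ‖e‖ ^ 2 ≤ B e e := fun e => (htouch e).1
  have hT := neg_le_trace_sub hM0 hlow p
  rw [hpP] at hT
  have hS : -M ≤ B p p / P := by
    rcases hP0.eq_or_lt with h | h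
    · rw [← h, div_zero]; linarith
    · rw [le_div_iff₀ h, ← hpP]; exact hlow p
  have heq := hreg.nondivergence hε hy hv2
  set tr := ∑ i, B (EuclideanSpace.single i 1) (EuclideanSpace.single i 1) with htr
  have hQ : 0 < ε ^ 2 + P := by positivity
  set l := ε ^ 2 / (ε ^ 2 + P) with hl
  have hl0 : 0 ≤ l := by positivity
  have hl1 : l ≤ 1 := by rw [hl, div_le_one hQ]; linarith
  have hsplit : tr - B p p / (ε ^ 2 + P) = (tr - B p p / P) + l * (B p p / P) := by
    rcases hP0.eq_or_lt with h | h
    · have hp0 : p = 0 := by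
        rw [← norm_eq_zero, ← sq_eq_zero_iff, hpP, ← h]
      simp [hp0]
    · rw [hl]; field_simp; ring
  rw [hsplit] at heq
  have hlS : -(l * M) ≤ l * (B p p / P) := by
    rw [← mul_neg]; exact mul_le_mul_of_nonneg_left hS hl0
  have hlM : l * M ≤ M := mul_le_of_le_one_left hM0 hl1
  have hQle : (ε ^ 2 + P) ^ ((1 - 1 / k) / 2) ≤ (n + 2) * M := by linarith
  have hQpos : 0 < (ε ^ 2 + P) ^ ((1 - 1 / k) / 2) := Real.rpow_pos_of_pos hQ _
  have hz : x - y ≠ 0 := fun h => by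
    rw [hM, h, norm_zero, Real.zero_rpow (by linarith)] at hQle
    simp only [mul_zero] at hQle
    linarith
  have hr : 0 < ‖x - y‖ := norm_pos_iff.2 hz
  set R := ε ^ (-α) * ‖x - y‖ ^ (γ - 1) with hR
  have hRpos : 0 < R := by positivity
  have hpR : p = (ε ^ (-α) * ‖x - y‖ ^ (γ - 2)) • (x - y) := by
    ext i
    change fderiv ℝ v y (EuclideanSpace.single i 1) = _
    rw [(htouch _).2 hz, EuclideanSpace.inner_single_right]
    simp
  have hPR : P = R ^ 2 := by
    rw [← hpP, hpR, norm_smul, Real.norm_eq_abs, abs_of_pos (by positivity), hR,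
      show γ - 1 = γ - 2 + 1 by ring, Real.rpow_add_one hr.ne', mul_assoc]
  have hsqrt : Real.sqrt P = R := by rw [hPR, Real.sqrt_sq hRpos.le]
  have hPpow : P ^ ((1 - 1 / k) / 2) = R ^ (1 - 1 / k) := by
    rw [hPR, ← Real.rpow_natCast, ← Real.rpow_mul hRpos.le]
    congr 1; push_cast; ring
  have hmono : R ^ (1 - 1 / k) ≤ (ε ^ 2 + P) ^ ((1 - 1 / k) / 2) := by
    rw [← hPpow]
    exact Real.rpow_le_rpow hP0 (le_add_of_nonneg_left (sq_nonneg ε)) (by positivity)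
  refine ⟨hr, hmono.trans hQle, ?_⟩
  have hεs : ε ^ s < 1 := Real.rpow_lt_one hε.le hε1 hs
  have hxy : x - (x - y) = y := sub_sub_cancel x y
  have hloc : IsLocalMax (fun x' => (1 - ε ^ s) ^ k * u x' - v (x' - (x - y))) x := by
    have htend : Tendsto (fun x' : Euc n => x' - (x - y)) (𝓝 x) (𝓝 y) := by
      have : ContinuousAt (fun x' : Euc n => x' - (x - y)) x := by fun_prop
      rwa [ContinuousAt, hxy] at this
    filter_upwards [hΩ.mem_nhds hx, htend.eventually (hΩ.mem_nhds hy)] with x' h1 h2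
    have := hmax x' h1 _ h2
    simp only [wFun, sub_sub_cancel] at this
    simp only [hxy]
    linarith
  have hsub := hu.translate (a := 1 - ε ^ s) (v := v) (z := x - y) hk (by linarith) hx
    (by rw [hxy]; filter_upwards [hΩ.mem_nhds hy] with w hw using hvs w hw) hloc
    (by rw [hxy, ← hP, hPR]; positivity)
  rw [hxy, ← hP, ← hB, ← hp, ← htr, hsqrt] at hsub
  have hkey : ε ^ s * R ^ (1 - 1 / k) ≤ l * M := by linarith
  have hlP : l * P ≤ ε ^ 2 := by
    rw [hl, div_mul_eq_mul_div, div_le_iff₀ hQ]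
    exact mul_le_mul_of_nonneg_left (le_add_of_nonneg_left (sq_nonneg ε)) (sq_nonneg ε)
  rw [Real.rpow_two, Real.rpow_two, ← hPR]
  calc ε ^ s * R ^ (1 - 1 / k) * P ≤ l * M * P := mul_le_mul_of_nonneg_right hkey hP0
    _ = l * P * M := by ring
    _ ≤ ε ^ 2 * M := mul_le_mul_of_nonneg_right hlP hM0

/-- Under the parameter conditions `γ > 1 + k` and `β₁(α,s) > β₂(α,s)`, for all
sufficiently small `ε > 0` every maximizer `(x̂, ŷ)` of `w_ε` over
`closure Ω × closure Ω` satisfies `x̂ ∈ ∂Ω` or `ŷ ∈ ∂Ω`. -/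
theorem stmt5 (n : ℕ) (k γ α s : ℝ) (hk : 1 < k) (hγ : 1 + k < γ)
    (hα : 0 < α) (hs : 0 < s)
    (hβ : (α + k * s) / (γ - k - 1) <
      (2 - s + α * (2 - 1 / k)) / (γ * (2 - 1 / k) + 1 / k - 1))
    (Ω : Set (Euc n)) (hΩo : IsOpen Ω) (hΩb : IsBounded Ω)
    (u : Euc n → ℝ) (uε : ℝ → Euc n → ℝ) (ε₁ : ℝ) (hε₁ : 0 < ε₁)
    (huc : ContinuousOn u (closure Ω))
    (hub : ∀ x ∈ frontier Ω, u x = 0)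
    (huv : IsViscSolution n k Ω u)
    (huε : ∀ ε : ℝ, 0 < ε → ε < ε₁ →
      ContDiffOn ℝ (⊤ : ℕ∞) (uε ε) (closure Ω) ∧
      SolvesReg n k ε Ω (uε ε) ∧
      (∀ x ∈ frontier Ω, uε ε x = 0)) :
    ∃ ε₀ : ℝ, 0 < ε₀ ∧ ∀ ε : ℝ, 0 < ε → ε < ε₀ →
      ∀ xh ∈ closure Ω, ∀ yh ∈ closure Ω,
        (∀ x ∈ closure Ω, ∀ y ∈ closure Ω,
          wFun n k γ α s ε u (uε ε) x y ≤ wFun n k γ α s ε u (uε ε) xh yh) →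
        xh ∈ frontier Ω ∨ yh ∈ frontier Ω := by
  obtain ⟨ε₀, hε₀, hfalse⟩ := exists_pos_forall_estimates_false (C := (n : ℝ) + 2) hk hγ hs
    (by positivity) hβ
  refine ⟨min ε₀ (min ε₁ 1), by positivity, fun ε hε hlt xh hxh yh hyh hmax => ?_⟩
  obtain ⟨hlt₀, hlt₁, hlt1⟩ : ε < ε₀ ∧ ε < ε₁ ∧ ε < 1 := by simpa using hlt
  by_contra! hcon
  have hmem : ∀ w ∈ closure Ω, w ∉ frontier Ω → w ∈ Ω := fun w hw hw' => by
    by_contra h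
    exact hw' (by rw [hΩo.frontier_eq]; exact ⟨hw, h⟩)
  obtain ⟨hsm, hreg, -⟩ := huε ε hε hlt₁
  obtain ⟨hr, h1, h2⟩ := interior_max_estimates hk hγ hs hε hlt1 hΩo huv.1
    (hsm.mono subset_closure) hreg (hmem xh hxh hcon.1) (hmem yh hyh hcon.2)
    fun x hx y hy => hmax x (subset_closure hx) y (subset_closure hy)
  exact hfalse ε _ hε hlt₀ hr h1 h2
end
end
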